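/- Define S_{k,l}(z) = ∑_{r=0}^{k-l} (-1)^r A_{k,l}^r I_{l+2r}(z) (and S_{k,l} = 0 if l > k or l < 0), P_k(v) = v^k(1-v)^{k-1}, Q(v) = v(1-v), R(v) = 1-3v, and S_k(v,a) = ∑_{l=0}^{k} (-2/a)^l P_k^{(l)}(v) S_{k,l}(a v). Then for k ≥ 1, a² S_{k+1}(v,a) = −4 ( Q(v)(∂_v² S_k(v,a) − a² S_k(v,a)) + R(v) ∂_v S_k(v,a) + (k²−1) S_k(v,a) − (k−1)k S_{k−1}(v,a) ). -/

import Mathlib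

/-- Binomial coefficient `C(n,r)` for integer arguments: zero if `r < 0` or
`0 ≤ n < r`, the usual binomial for `0 ≤ r ≤ n`, and the generalized binomial
for negative upper index. -/
def C (n r : ℤ) : ℤ :=
  if r < 0 then 0
  else if 0 ≤ n then (n.toNat.choose r.toNat : ℤ)
  else (-1) ^ r.toNat * ((r - n - 1).toNat.choose r.toNat : ℤ)

def A (k l r : ℤ) : ℤ :=
  C (l + r - 1) (r - 1) * C (2 * k - l - 1) (k - l - r - 1) + C (l + r) r * C (2 * k - l - 1) (k - l - r)

noncomputable def S (I : ℤ → ℂ → ℂ) (k l : ℕ) : ℂ → ℂ := fun z =>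
  ∑ r ∈ Finset.range (k - l + 1), (-1 : ℂ) ^ r * (A k l r : ℂ) * I (l + 2 * r) z

noncomputable def Pc (k : ℕ) : ℂ → ℂ := fun v => v ^ k * (1 - v) ^ (k - 1)

noncomputable def Qc : ℂ → ℂ := fun v => v * (1 - v)

noncomputable def Rc : ℂ → ℂ := fun v => 1 - 3 * v

noncomputable def Sfun (I : ℤ → ℂ → ℂ) (k : ℕ) (a : ℂ) : ℂ → ℂ := fun v =>
  ∑ l ∈ Finset.range (k + 1), (-2 / a) ^ l * iteratedDeriv l (Pc k) v * S I k l (a * v)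


set_option linter.all false

def fi (n : ℤ) : ℚ := if n < 0 then 0 else 1 / (n.toNat.factorial : ℚ)
def fg (n : ℤ) : ℚ := (n.toNat.factorial : ℚ)

lemma fg_rec (n : ℤ) (hn : 1 ≤ n) : fg n = n * fg (n - 1) := by
  obtain ⟨m, rfl⟩ : ∃ m : ℕ, n = m + 1 := ⟨(n - 1).toNat, by omega⟩
  simp only [fg]
  rw [show ((m : ℤ) + 1 - 1).toNat = m by omega, show ((m : ℤ) + 1).toNat = m + 1 by omega,
    Nat.factorial_succ]
  push_cast; ring

lemma fi_rec (n : ℤ) : fi (n - 1) = n * fi n := by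
  rcases lt_trichotomy n 0 with h | h | h
  · simp [fi, h, show n - 1 < 0 by omega]
  · subst h; simp [fi]
  · obtain ⟨m, rfl⟩ : ∃ m : ℕ, n = m + 1 := ⟨(n - 1).toNat, by omega⟩
    simp only [fi]
    rw [show ((m : ℤ) + 1 - 1).toNat = m by omega, show ((m : ℤ) + 1).toNat = m + 1 by omega,
      Nat.factorial_succ, if_neg (by omega), if_neg (by omega)]
    have := Nat.factorial_ne_zero m
    push_cast; field_simp

lemma fi_neg (n : ℤ) (h : n < 0) : fi n = 0 := by simp [fi, h]

lemma C_neg (n r : ℤ) (h : r < 0) : C n r = 0 := by simp [C, h]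

lemma C_eq (n r : ℤ) (hn : 0 ≤ n) : (C n r : ℚ) = fg n * fi r * fi (n - r) := by
  by_cases hr : r < 0
  · simp [C_neg _ _ hr, fi_neg _ hr]
  by_cases h : n < r
  · rw [fi_neg (n - r) (by omega)]
    simp only [C, if_neg hr, if_pos hn]
    rw [Nat.choose_eq_zero_of_lt (by omega)]; simp
  · simp only [C, if_neg hr, if_pos hn, fi, fg, if_neg (show ¬ (n - r < 0) by omega)]
    push_cast
    rw [Nat.cast_choose ℚ (show r.toNat ≤ n.toNat by omega),
      show (n - r).toNat = n.toNat - r.toNat by omega]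
    field_simp

lemma A_zero (k l r : ℤ) (h : r < 0 ∨ k < l + r) : A k l r = 0 := by
  unfold A
  rcases h with h | h
  · rw [C_neg _ (r - 1) (by omega), C_neg _ r h]; simp
  · rw [C_neg _ (k - l - r - 1) (by omega), C_neg _ (k - l - r) (by omega)]; simp

lemma A_eq (k l r : ℤ) (hk : 1 ≤ k) (hl : 0 ≤ l) (h : 1 ≤ l + r) :
    (A k l r : ℚ) = k * (l + 2 * r) * fg (l + r - 1) * fg (2 * k - l - 1) * fi l * fi r *
      fi (k - l - r) * fi (k + r) := by
  by_cases hr : r < 0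
  · rw [A_zero _ _ _ (Or.inl hr), fi_neg r hr]; simp
  by_cases hr2 : k < l + r
  · rw [A_zero _ _ _ (Or.inr hr2), fi_neg (k - l - r) (by omega)]; simp
  unfold A
  push_cast
  rw [C_eq _ (r - 1) (by omega), C_eq _ (k - l - r - 1) (by omega), C_eq _ r (by omega),
    C_eq _ (k - l - r) (by omega)]
  rw [show l + r - 1 - (r - 1) = l by ring, show l + r - r = l by ring,
    show 2 * k - l - 1 - (k - l - r - 1) = k + r by ring,
    show 2 * k - l - 1 - (k - l - r) = k + r - 1 by ring, fi_rec r, fi_rec (k - l - r),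
    fi_rec (k + r), fg_rec (l + r) h]
  push_cast; ring

lemma A_00 (k : ℤ) (hk : 1 ≤ k) : (A k 0 0 : ℚ) = fg (2 * k - 1) * k * fi k * fi k := by
  have h : A k 0 0 = C (2 * k - 1) k := by
    unfold A
    rw [C_neg _ (0 - 1) (by omega)]
    simp [C]
  rw [h, C_eq _ k (by omega), show 2 * k - 1 - k = k - 1 by ring, fi_rec k]; ring

lemma fi_zero : fi 0 = 1 := by simp [fi]
lemma fi_one : fi 1 = 1 := by simp [fi]
lemma fi_two : fi 2 = 1 / 2 := by
  have : Int.toNat 2 = 2 := rfl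
  norm_num [fi, this]
lemma fg_zero : fg 0 = 1 := by simp [fg]
lemma fg_one : fg 1 = 1 := by simp [fg]
lemma fg_fi (n : ℤ) (h : 0 ≤ n) : fg n * fi n = 1 := by
  have := Nat.factorial_ne_zero n.toNat
  simp only [fi, fg, if_neg (show ¬ n < 0 by omega)]; field_simp

/-- the three coefficient identities, for `l < k`, `2 ≤ k`. -/
lemma coefs (k l j : ℤ) (hk : 2 ≤ k) (hl : 0 ≤ l) (hlk : l < k) (hj : 0 ≤ j) :
    (-((A k (l + 2) j : ℚ) + 2 * A k (l + 2) (j - 1) + A k (l + 2) (j - 2))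
        + (A k (l + 1) j - A k (l + 1) (j - 1)) = - A (k + 1) (l + 2) (j - 1) + A (k - 1) l j) ∧
    (-(l + 2 : ℚ) * A (k + 1) (l + 2) (j - 1)
      = (k - l) * (A k (l + 1) j - A k (l + 1) (j - 1) - A k l j)
        + (2 * k - l - 2) * A (k - 1) l j) ∧
    ((k - 1 : ℚ) * ((l + 1) * (A k (l + 1) j - A k (l + 1) (j - 1)) + (k - l) * A k l j)
      = 2 * k * (2 * k - l - 2) * A (k - 1) l j) := by
  have g2 : fg (2 * k - l - 2) = (2 * k - l - 2) * fg (2 * k - l - 3) := by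
    rw [fg_rec _ (by omega)]; push_cast; congr 2; ring
  have g1 : fg (2 * k - l - 1) = (2 * k - l - 1) * ((2 * k - l - 2) * fg (2 * k - l - 3)) := by
    rw [fg_rec _ (by omega), ← g2]; push_cast; congr 2; ring
  have l1 : fi (l + 1) = (l + 2) * fi (l + 2) := by
    have := fi_rec (l + 2); rw [show l + 2 - 1 = l + 1 by ring] at this; rw [this]; push_cast; ring
  have l0 : fi l = (l + 1) * ((l + 2) * fi (l + 2)) := by
    have := fi_rec (l + 1); rw [show l + 1 - 1 = l by ring] at this; rw [this, l1]; push_cast; ring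
  have j1 : fi (j - 1) = j * fi j := fi_rec j
  have j2 : fi (j - 2) = (j - 1) * (j * fi j) := by
    have := fi_rec (j - 1); rw [show j - 1 - 1 = j - 2 by ring] at this; rw [this, j1]; push_cast; ring
  have m1 : fi (k - l - j - 1) = (k - l - j) * fi (k - l - j) := by
    rw [fi_rec]; push_cast; ring
  have m2 : fi (k - l - j - 2) = (k - l - j - 1) * ((k - l - j) * fi (k - l - j)) := by
    have := fi_rec (k - l - j - 1); rw [show k - l - j - 1 - 1 = k - l - j - 2 by ring] at this
    rw [this, m1]; push_cast; ring
  have n1 : fi (k + j - 1) = (k + j) * fi (k + j) := by rw [fi_rec]; push_cast; ring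
  have n2 : fi (k + j - 2) = (k + j - 1) * ((k + j) * fi (k + j)) := by
    have := fi_rec (k + j - 1); rw [show k + j - 1 - 1 = k + j - 2 by ring] at this
    rw [this, n1]; push_cast; ring
  rcases (show l + j = 0 ∨ 1 ≤ l + j by omega) with h0 | h1
  · obtain rfl : l = 0 := by omega
    obtain rfl : j = 0 := by omega
    rw [A_zero k _ (0 - 1) (by omega), A_zero k _ (0 - 2) (by omega),
      A_zero k _ (0 - 1) (by omega), A_zero (k + 1) _ (0 - 1) (by omega),
      A_eq k (0 + 2) 0 (by omega) (by omega) (by omega),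
      A_eq k (0 + 1) 0 (by omega) (by omega) (by omega), A_00 k (by omega), A_00 (k - 1) (by omega)]
    have e1 : 2 * (k - 1) - 1 = 2 * k - 3 := by ring
    have e2 : 2 * k - 2 - 1 = 2 * k - 3 := by ring
    have e3 : 2 * k - 1 - 1 = 2 * k - 2 := by ring
    simp only [sub_zero, add_zero] at g1 g2 n1 n2
    simp only [sub_zero, e1, e2, e3, add_zero, n1, n2, g1, g2, fi_zero, zero_add, fi_one, fi_two,
      show (2 : ℤ) - 1 = 1 by norm_num, show (1 : ℤ) - 1 = 0 by norm_num, fg_zero, fg_one]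
    push_cast
    refine ⟨?_, ?_, ?_⟩ <;> ring
  · have h2 : fg (l + j) = (l + j) * fg (l + j - 1) := by rw [fg_rec _ h1]; push_cast; ring
    have h3 : fg (l + j + 1) = (l + j + 1) * ((l + j) * fg (l + j - 1)) := by
      rw [fg_rec _ (by omega), ← h2]; push_cast; congr 2; ring
    rw [A_eq k (l + 2) j (by omega) (by omega) (by omega),
      A_eq k (l + 2) (j - 1) (by omega) (by omega) (by omega),
      A_eq k (l + 1) j (by omega) (by omega) (by omega),
      A_eq k (l + 1) (j - 1) (by omega) (by omega) (by omega),
      A_eq k l j (by omega) (by omega) (by omega),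
      A_eq (k - 1) l j (by omega) (by omega) (by omega),
      A_eq (k + 1) (l + 2) (j - 1) (by omega) (by omega) (by omega),
      A_eq k (l + 2) (j - 2) (by omega) (by omega) (by omega)]
    have e1 : l + 2 + j - 1 = l + j + 1 := by ring
    have e2 : l + 2 + (j - 1) - 1 = l + j := by ring
    have e3 : l + 2 + (j - 2) - 1 = l + j - 1 := by ring
    have e4 : l + 1 + j - 1 = l + j := by ring
    have e5 : l + 1 + (j - 1) - 1 = l + j - 1 := by ring
    have e6 : 2 * k - (l + 2) - 1 = 2 * k - l - 3 := by ring
    have e7 : 2 * k - (l + 1) - 1 = 2 * k - l - 2 := by ring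
    have e8 : 2 * (k + 1) - (l + 2) - 1 = 2 * k - l - 1 := by ring
    have e9 : 2 * (k - 1) - l - 1 = 2 * k - l - 3 := by ring
    have f1 : k - (l + 2) - j = k - l - j - 2 := by ring
    have f2 : k - (l + 2) - (j - 1) = k - l - j - 1 := by ring
    have f3 : k - (l + 2) - (j - 2) = k - l - j := by ring
    have f4 : k - (l + 1) - j = k - l - j - 1 := by ring
    have f5 : k - (l + 1) - (j - 1) = k - l - j := by ring
    have f6 : k - 1 - l - j = k - l - j - 1 := by ring
    have f7 : k + 1 - (l + 2) - (j - 1) = k - l - j := by ring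
    have f8 : k + (j - 1) = k + j - 1 := by ring
    have f9 : k + (j - 2) = k + j - 2 := by ring
    have f10 : k + 1 + (j - 1) = k + j := by ring
    have f11 : k - 1 + j = k + j - 1 := by ring
    simp only [e1, e2, e3, e4, e5, e6, e7, e8, e9, f1, f2, f3, f4, f5, f6, f7, f8, f9, f10, f11]
    simp only [h3, h2, g1, g2, l0, l1, j1, j2, m1, m2, n1, n2]
    push_cast
    refine ⟨?_, ?_, ?_⟩ <;> ring

lemma coefs_all (k l j : ℤ) (hk : 1 ≤ k) (hl : 0 ≤ l) (hj : 0 ≤ j) :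
    (-(A k (l + 2) j + 2 * A k (l + 2) (j - 1) + A k (l + 2) (j - 2))
        + (A k (l + 1) j - A k (l + 1) (j - 1)) = - A (k + 1) (l + 2) (j - 1) + A (k - 1) l j) ∧
    (-(l + 2) * A (k + 1) (l + 2) (j - 1)
      = (k - l) * (A k (l + 1) j - A k (l + 1) (j - 1) - A k l j)
        + (2 * k - l - 2) * A (k - 1) l j) ∧
    ((k - 1) * ((l + 1) * (A k (l + 1) j - A k (l + 1) (j - 1)) + (k - l) * A k l j)
      = 2 * k * (2 * k - l - 2) * A (k - 1) l j) := by
  by_cases hlk : l < k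
  · by_cases hk2 : 2 ≤ k
    · obtain ⟨h1, h2, h3⟩ := coefs k l j hk2 hl hlk hj
      exact ⟨by exact_mod_cast h1, by exact_mod_cast h2, by exact_mod_cast h3⟩
    · obtain rfl : k = 1 := by omega
      obtain rfl : l = 0 := by omega
      rcases (show j = 0 ∨ j = 1 ∨ 2 ≤ j by omega) with h | h | h
      · subst h; decide
      · subst h; decide
      · rw [A_zero 1 (0 + 2) j (by omega), A_zero 1 (0 + 2) (j - 1) (by omega),
          A_zero 1 (0 + 2) (j - 2) (by omega), A_zero 1 (0 + 1) j (by omega),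
          A_zero 1 (0 + 1) (j - 1) (by omega), A_zero (1 + 1) (0 + 2) (j - 1) (by omega),
          A_zero (1 - 1) 0 j (by omega), A_zero 1 0 j (by omega)]
        simp
  · rw [A_zero k (l + 2) j (by omega), A_zero k (l + 2) (j - 1) (by omega),
      A_zero k (l + 2) (j - 2) (by omega), A_zero k (l + 1) j (by omega),
      A_zero k (l + 1) (j - 1) (by omega), A_zero (k + 1) (l + 2) (j - 1) (by omega),
      A_zero (k - 1) l j (by omega)]
    have : (k - l) * A k l j = 0 := by
      rcases (show k = l ∨ k < l + j by omega) with h | h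
      · subst h; simp
      · rw [A_zero k l j (by omega)]; simp
    refine ⟨by simp, by linear_combination this, by linear_combination (k - 1) * this⟩

/-- symmetric closed form for `l = 0` -/
def A0 (k r : ℤ) : ℚ := 2 * k * fg (2 * k - 1) * fi (k - r) * fi (k + r)
/-- antisymmetric closed form for `l = 1` -/
def A1 (k r : ℤ) : ℚ := k * (1 + 2 * r) * fg (2 * k - 2) * fi (k - r - 1) * fi (k + r)

lemma A_A0 (k r : ℤ) (hk : 1 ≤ k) (hr : 1 ≤ r) : (A k 0 r : ℚ) = A0 k r := by
  rw [A_eq k 0 r hk le_rfl (by omega)]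
  have h := fg_fi r (by omega)
  rw [fg_rec r hr] at h
  simp only [zero_add, sub_zero, fi_zero, A0]
  push_cast
  linear_combination (2 * k * fg (2 * k - 1) * fi (k - r) * fi (k + r)) * h

lemma A_A00 (k : ℤ) (hk : 1 ≤ k) : (A k 0 0 : ℚ) = A0 k 0 / 2 := by
  rw [A_00 k hk]
  simp only [A0, sub_zero, add_zero]; ring

lemma A_A1 (k r : ℤ) (hk : 1 ≤ k) (hr : 0 ≤ r) : (A k 1 r : ℚ) = A1 k r := by
  rw [A_eq k 1 r hk (by omega) (by omega)]
  have h := fg_fi r (by omega)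
  simp only [fi_one, A1, show 1 + r - 1 = r by ring, show 2 * k - 1 - 1 = 2 * k - 2 by ring,
    show k - 1 - r = k - r - 1 by ring]
  push_cast
  linear_combination (k * (1 + 2 * r) * fg (2 * k - 2) * fi (k - r - 1) * fi (k + r)) * h

lemma A0_symm (k r : ℤ) : A0 k (-r) = A0 k r := by
  simp only [A0, sub_neg_eq_add, ← sub_eq_add_neg]; ring

lemma A1_neg (k : ℤ) : A1 k (-1) = - A1 k 0 := by
  simp only [A1, show k - -1 - 1 = k - 0 by ring, show k + -1 = k - 0 - 1 by ring, sub_zero,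
    add_zero]
  push_cast; ring

lemma coefs01 (k j : ℤ) (hk : 1 ≤ k) :
    (A1 k (j + 1) + 2 * A1 k j + A1 k (j - 1) + A0 k j - A0 k (j + 1) = A1 (k + 1) j) ∧
    (A1 (k + 1) j = (k + 1) * (A0 k j - A0 k (j + 1))) ∧
    (A0 (k + 1) j = A0 k (j + 1) + 2 * A0 k j + A0 k (j - 1)) := by
  have g1 : fg (2 * k - 1) = (2 * k - 1) * fg (2 * k - 2) := by
    rw [fg_rec _ (by omega)]; push_cast; congr 2; ring
  have g2 : fg (2 * k) = 2 * k * ((2 * k - 1) * fg (2 * k - 2)) := by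
    rw [fg_rec _ (by omega), ← g1]; push_cast; ring
  have g3 : fg (2 * k + 1) = (2 * k + 1) * (2 * k * ((2 * k - 1) * fg (2 * k - 2))) := by
    rw [fg_rec _ (by omega), ← g2]; push_cast; congr 2; ring
  -- bases: `fi (k - j + 1)`, `fi (k + j + 1)`
  have m0 : fi (k - j) = (k - j + 1) * fi (k - j + 1) := by
    have := fi_rec (k - j + 1); rw [show k - j + 1 - 1 = k - j by ring] at this
    rw [this]; push_cast; ring
  have m1 : fi (k - j - 1) = (k - j) * ((k - j + 1) * fi (k - j + 1)) := by
    rw [fi_rec, m0]; push_cast; ring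
  have m2 : fi (k - j - 2) = (k - j - 1) * ((k - j) * ((k - j + 1) * fi (k - j + 1))) := by
    have := fi_rec (k - j - 1); rw [show k - j - 1 - 1 = k - j - 2 by ring] at this
    rw [this, m1]; push_cast; ring
  have n0 : fi (k + j) = (k + j + 1) * fi (k + j + 1) := by
    have := fi_rec (k + j + 1); rw [show k + j + 1 - 1 = k + j by ring] at this
    rw [this]; push_cast; ring
  have n1 : fi (k + j - 1) = (k + j) * ((k + j + 1) * fi (k + j + 1)) := by
    rw [fi_rec, n0]; push_cast; ring
  have e1 : k - (j + 1) - 1 = k - j - 2 := by ring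
  have e2 : k + (j + 1) = k + j + 1 := by ring
  have e3 : k - (j - 1) - 1 = k - j := by ring
  have e4 : k + (j - 1) = k + j - 1 := by ring
  have e5 : k - (j + 1) = k - j - 1 := by ring
  have e6 : k - (j - 1) = k - j + 1 := by ring
  have e7 : 2 * (k + 1) - 2 = 2 * k := by ring
  have e8 : 2 * (k + 1) - 1 = 2 * k + 1 := by ring
  have e9 : k + 1 - j - 1 = k - j := by ring
  have e10 : k + 1 + j = k + j + 1 := by ring
  have e11 : k + 1 - j = k - j + 1 := by ring
  have e12 : k - j + 1 - 1 = k - j := by ring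
  simp only [A1, A0, e1, e2, e3, e4, e7, e8, e9, e10, e11]
  simp only [e5, e6, e12, m2, m1, n1, g3, g2, g1, m0, n0]
  push_cast
  refine ⟨?_, ?_, ?_⟩ <;> ring

lemma coefs1 (k j : ℤ) (hk : 1 ≤ k) (hj : 0 ≤ j) :
    (A k 1 (j + 1) + 2 * A k 1 j + A k 1 (j - 1) + A k 0 j - A k 0 (j + 1)
      + (if j = 0 then A k 0 0 - A k 1 0 else 0) = A (k + 1) 1 j) ∧
    (A (k + 1) 1 j = (k + 1) * (A k 0 j - A k 0 (j + 1) + (if j = 0 then A k 0 0 else 0))) := by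
  obtain ⟨h1, h2, -⟩ := coefs01 k j hk
  by_cases h : j = 0
  · subst h
    simp only [zero_add, zero_sub, A1_neg, if_true] at *
    rw [A_zero k 1 (-1) (by omega)]
    rw [← A_A0 k 1 hk le_rfl, ← A_A1 (k + 1) 0 (by omega) le_rfl] at h1 h2
    rw [← A_A1 k 1 hk (by omega), ← A_A1 k 0 hk le_rfl] at h1
    have h3 := A_A00 k hk
    constructor
    · have : (A k 1 1 + 2 * A k 1 0 + 0 + A k 0 0 - A k 0 1 + (A k 0 0 - A k 1 0) : ℚ)
        = A (k + 1) 1 0 := by linear_combination h1 + 2 * h3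
      exact_mod_cast this
    · have : (A (k + 1) 1 0 : ℚ) = (k + 1) * (A k 0 0 - A k 0 1 + A k 0 0) := by
        linear_combination h2 - 2 * (k + 1) * h3
      exact_mod_cast this
  · simp only [if_neg h, add_zero]
    rw [← A_A0 k j hk (by omega), ← A_A0 k (j + 1) hk (by omega),
      ← A_A1 (k + 1) j (by omega) (by omega)] at h1 h2
    rw [← A_A1 k j hk (by omega), ← A_A1 k (j + 1) hk (by omega),
      ← A_A1 k (j - 1) hk (by omega)] at h1
    exact ⟨by exact_mod_cast h1, by exact_mod_cast h2⟩

lemma coefs0 (k j : ℤ) (hk : 1 ≤ k) (hj : 0 ≤ j) :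
    A (k + 1) 0 j = A k 0 (j + 1) + 2 * A k 0 j + A k 0 (j - 1)
      + (if j = 1 then A k 0 0 else 0) := by
  obtain ⟨-, -, h1⟩ := coefs01 k j hk
  rcases (show j = 0 ∨ j = 1 ∨ 2 ≤ j by omega) with h | h | h
  · subst h
    simp only [zero_add, zero_sub, A0_symm] at h1
    rw [A_zero k 0 (0 - 1) (by omega)]
    rw [← A_A0 k 1 hk le_rfl] at h1
    have h3 := A_A00 k hk
    have h4 := A_A00 (k + 1) (by omega)
    have : (A (k + 1) 0 0 : ℚ) = A k 0 1 + 2 * A k 0 0 := by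
      linear_combination h4 - 2 * h3 + h1 / 2
    have : (A (k + 1) 0 0) = A k 0 1 + 2 * A k 0 0 := by exact_mod_cast this
    simpa using this
  · subst h
    simp only [sub_self] at *
    rw [← A_A0 k 1 hk le_rfl, ← A_A0 k (1 + 1) hk (by omega), ← A_A0 (k + 1) 1 (by omega) le_rfl]
      at h1
    have h3 := A_A00 k hk
    have : (A (k + 1) 0 1 : ℚ) = A k 0 (1 + 1) + 2 * A k 0 1 + A k 0 0 + A k 0 0 := by
      linear_combination h1 - 2 * h3
    simpa using (by exact_mod_cast this :
      A (k + 1) 0 1 = A k 0 (1 + 1) + 2 * A k 0 1 + A k 0 0 + A k 0 0)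
  · rw [← A_A0 k j hk (by omega), ← A_A0 k (j + 1) hk (by omega), ← A_A0 k (j - 1) hk (by omega),
      ← A_A0 (k + 1) j (by omega) (by omega)] at h1
    rw [if_neg (by omega), add_zero]
    exact_mod_cast h1

lemma sum_shift_up (f g : ℤ → ℂ) (N : ℕ) (h0 : f (-1) = 0) (hN : f N = 0) :
    ∑ r ∈ Finset.range (N + 1), f r * g (r + 1) = ∑ r ∈ Finset.range (N + 1), f (r - 1) * g r := by
  rw [Finset.sum_range_succ, Finset.sum_range_succ' (fun r : ℕ => f (r - 1) * g r)]
  simp [h0, hN]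

lemma sum_shift_down (f g : ℤ → ℂ) (N : ℕ) (hN : f (N + 1) = 0) :
    ∑ r ∈ Finset.range (N + 1), f r * g (r - 1)
      = f 0 * g (-1) + ∑ r ∈ Finset.range (N + 1), f (r + 1) * g r := by
  rw [Finset.sum_range_succ', Finset.sum_range_succ (fun r : ℕ => f (r + 1) * g r)]
  simp [hN, add_comm]

/-- signed Bessel sequence -/
noncomputable def G (I : ℤ → ℂ → ℂ) (l : ℤ) (z : ℂ) (j : ℤ) : ℂ := (-1 : ℂ) ^ j * I (l + 2 * j) z

/-- first derivative of `S` -/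
noncomputable def S1 (I : ℤ → ℂ → ℂ) (k l : ℕ) : ℂ → ℂ := fun z =>
  ∑ r ∈ Finset.range (k - l + 1), (-1 : ℂ) ^ r * (A k l r : ℂ) *
    ((I (l + 2 * r - 1) z + I (l + 2 * r + 1) z) / 2)

/-- second derivative of `S` -/
noncomputable def S2 (I : ℤ → ℂ → ℂ) (k l : ℕ) : ℂ → ℂ := fun z =>
  ∑ r ∈ Finset.range (k - l + 1), (-1 : ℂ) ^ r * (A k l r : ℂ) *
    ((I (l + 2 * r - 2) z + 2 * I (l + 2 * r) z + I (l + 2 * r + 2) z) / 4)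

lemma sum_extend (k l N : ℕ) (hN : k ≤ N) (F : ℕ → ℂ) :
    ∑ r ∈ Finset.range (k - l + 1), (-1 : ℂ) ^ r * (A k l r : ℂ) * F r
      = ∑ r ∈ Finset.range (N + 1), (A k l r : ℂ) * ((-1 : ℂ) ^ r * F r) := by
  rw [Finset.sum_subset (Finset.range_mono (show k - l + 1 ≤ N + 1 by omega))]
  · exact Finset.sum_congr rfl fun r _ => by ring
  · intro r _ hr
    rw [Finset.mem_range] at hr
    rw [A_zero k l r (by omega)]; simp

lemma S_eq (I : ℤ → ℂ → ℂ) (k l N : ℕ) (hN : k ≤ N) (z : ℂ) :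
    S I k l z = ∑ r ∈ Finset.range (N + 1), (A k l r : ℂ) * G I l z r := by
  simp only [S]
  rw [sum_extend k l N hN (fun r => I (l + 2 * r) z)]
  simp [G]

lemma G_shift (I : ℤ → ℂ → ℂ) (l : ℤ) (z : ℂ) (j : ℤ) : G I (l + 2) z j = - G I l z (j + 1) := by
  simp only [G]
  rw [zpow_add_one₀ (by norm_num), show l + 2 + 2 * j = l + 2 * (j + 1) by ring]; ring

lemma S1_eq (I : ℤ → ℂ → ℂ) (k l N : ℕ) (hN : k ≤ N) (z : ℂ) :
    2 * S1 I k l z = ∑ r ∈ Finset.range (N + 1), (A k l r : ℂ) *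
      (G I (l - 1) z r - G I (l - 1) z (r + 1)) := by
  simp only [S1]
  rw [sum_extend k l N hN (fun r => (I (l + 2 * r - 1) z + I (l + 2 * r + 1) z) / 2),
    Finset.mul_sum]
  refine Finset.sum_congr rfl fun r _ => ?_
  simp only [G]
  rw [zpow_add_one₀ (by norm_num), show (l : ℤ) - 1 + 2 * (r + 1) = l + 2 * r + 1 by ring,
    show (l : ℤ) - 1 + 2 * r = l + 2 * r - 1 by ring]
  simp only [zpow_natCast]
  ring

lemma S2_eq (I : ℤ → ℂ → ℂ) (k l N : ℕ) (hN : k ≤ N) (z : ℂ) :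
    -4 * (S2 I k l z - S I k l z) = ∑ r ∈ Finset.range (N + 1), (A k l r : ℂ) *
      (G I l z (r - 1) + 2 * G I l z r + G I l z (r + 1)) := by
  rw [S_eq I k l N hN]
  simp only [S2]
  rw [sum_extend k l N hN (fun r => (I (l + 2 * r - 2) z + 2 * I (l + 2 * r) z
    + I (l + 2 * r + 2) z) / 4), ← Finset.sum_sub_distrib,
    Finset.mul_sum]
  refine Finset.sum_congr rfl fun r _ => ?_
  simp only [G]
  rw [zpow_add_one₀ (by norm_num), zpow_sub_one₀ (by norm_num),
    show (l : ℤ) + 2 * (r + 1) = l + 2 * r + 2 by ring,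
    show (l : ℤ) + 2 * (r - 1) = l + 2 * r - 2 by ring]
  simp only [zpow_natCast]
  norm_num
  ring

/-- the identities for `m = l + 2` -/
lemma E_gen (I : ℤ → ℂ → ℂ) (k l : ℕ) (hk : 1 ≤ k) (z : ℂ) :
    (-4 * (S2 I k (l + 2) z - S I k (l + 2) z) + 2 * S1 I k (l + 1) z
      = S I (k + 1) (l + 2) z + S I (k - 1) l z) ∧
    ((l + 2 : ℂ) * S I (k + 1) (l + 2) z
      = (k - l) * (2 * S1 I k (l + 1) z - S I k l z) + (2 * k - l - 2) * S I (k - 1) l z) ∧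
    ((k - 1 : ℂ) * ((l + 1) * (2 * S1 I k (l + 1) z) + (k - l) * S I k l z)
      = 2 * k * (2 * k - l - 2) * S I (k - 1) l z) := by
  set N := k + 3 with hN
  set g := G I l z with hg
  have hc : ((k - 1 : ℕ) : ℤ) = (k : ℤ) - 1 := by omega
  have e1 : 2 * S1 I k (l + 1) z = ∑ r ∈ Finset.range (N + 1),
      ((A k (l + 1) r : ℂ) - A k (l + 1) (r - 1)) * g r := by
    rw [S1_eq I k (l + 1) N (by omega)]
    simp only [mul_sub, sub_mul, Finset.sum_sub_distrib]
    push_cast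
    rw [add_sub_cancel_right]
    congr 1
    exact sum_shift_up (fun r => (A k (l + 1) r : ℂ)) g N (by simp [A_zero])
      (by simp only [hN]; rw [A_zero _ _ _ (by omega)]; simp)
  have e2 : -4 * (S2 I k (l + 2) z - S I k (l + 2) z) = ∑ r ∈ Finset.range (N + 1),
      -((A k (l + 2) r : ℂ) + 2 * A k (l + 2) (r - 1) + A k (l + 2) (r - 2)) * g r := by
    rw [S2_eq I k (l + 2) N (by omega)]
    push_cast
    have s1 := sum_shift_up (fun r => (A k (l + 2) r : ℂ)) g N (by simp [A_zero])
      (by simp only [hN]; rw [A_zero _ _ _ (by omega)]; simp)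
    have s2 := sum_shift_up (fun r => (A k (l + 2) r : ℂ)) (fun r => g (r + 1)) N
      (by simp [A_zero]) (by simp only [hN]; rw [A_zero _ _ _ (by omega)]; simp)
    have s3 := sum_shift_up (fun r => (A k (l + 2) (r - 1) : ℂ)) g N (by simp [A_zero])
      (by simp only [hN]; rw [A_zero _ _ _ (by omega)]; simp)
    simp only [G_shift, sub_add_cancel]
    have s4 : ∑ r ∈ Finset.range (N + 1), (A k (l + 2) ((r : ℤ) - 1 - 1) : ℂ) * g r
      = ∑ r ∈ Finset.range (N + 1), (A k (l + 2) ((r : ℤ) - 2) : ℂ) * g r :=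
      Finset.sum_congr rfl fun r _ => by rw [show (r : ℤ) - 1 - 1 = r - 2 by ring]
    simp only [neg_mul, add_mul, mul_add, mul_neg, Finset.sum_add_distrib, Finset.sum_neg_distrib]
    simp only [mul_left_comm _ (2 : ℂ), mul_assoc, ← Finset.mul_sum]
    linear_combination -2 * s1 - s2 - s3 - s4
  have e3 : S I (k + 1) (l + 2) z = ∑ r ∈ Finset.range (N + 1),
      -(A (k + 1) (l + 2) (r - 1) : ℂ) * g r := by
    rw [S_eq I (k + 1) (l + 2) N (by omega)]
    push_cast
    have s1 := sum_shift_up (fun r => (A (k + 1) (l + 2) r : ℂ)) g N (by simp [A_zero])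
      (by simp only [hN]; rw [A_zero _ _ _ (by omega)]; simp)
    simp only [G_shift, mul_neg, neg_mul, Finset.sum_neg_distrib]
    rw [s1]
  have e4 : S I k l z = ∑ r ∈ Finset.range (N + 1), (A k l r : ℂ) * g r :=
    S_eq I k l N (by omega) z
  have e5 : S I (k - 1) l z = ∑ r ∈ Finset.range (N + 1), (A (k - 1) l r : ℂ) * g r := by
    rw [S_eq I (k - 1) l N (by omega) z, hc]
  rw [e1, e2, e3, e4, e5]
  simp only [Finset.mul_sum, ← Finset.sum_sub_distrib, ← Finset.sum_add_distrib]
  have key := fun r : ℕ => coefs_all k l r (by omega) (by omega) (by omega)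
  refine ⟨Finset.sum_congr rfl fun r _ => ?_, Finset.sum_congr rfl fun r _ => ?_,
    Finset.sum_congr rfl fun r _ => ?_⟩
  · have h := congrArg (Int.cast : ℤ → ℂ) (key r).1
    push_cast at h
    linear_combination g r * h
  · have h := congrArg (Int.cast : ℤ → ℂ) (key r).2.1
    push_cast at h
    linear_combination g r * h
  · have h := congrArg (Int.cast : ℤ → ℂ) (key r).2.2
    push_cast at h
    linear_combination g r * h

lemma E_one (I : ℤ → ℂ → ℂ) (hsymm : ∀ ν : ℤ, I (-ν) = I ν) (k : ℕ) (hk : 1 ≤ k) (z : ℂ) :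
    (-4 * (S2 I k 1 z - S I k 1 z) + 2 * S1 I k 0 z = S I (k + 1) 1 z) ∧
    (S I (k + 1) 1 z = (k + 1) * (2 * S1 I k 0 z)) := by
  set N := k + 3 with hN
  set g := G I 1 z with hg
  have hg0 : g (-1) = - g 0 := by
    simp only [hg, G]
    rw [show (1 : ℤ) + 2 * (-1) = -(1 + 2 * 0) by norm_num, hsymm]; norm_num
  have z1 : (A k 1 (-1) : ℂ) = 0 := by rw [A_zero _ _ _ (by omega)]; simp
  have z2 : (A k 1 (N : ℤ) : ℂ) = 0 := by rw [A_zero _ _ _ (by omega)]; simp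
  have z3 : (A k 1 ((N : ℤ) + 1) : ℂ) = 0 := by rw [A_zero _ _ _ (by omega)]; simp
  have z4 : (A k 0 ((N : ℤ) + 1) : ℂ) = 0 := by rw [A_zero _ _ _ (by omega)]; simp
  have e1 : 2 * S1 I k 0 z = ∑ r ∈ Finset.range (N + 1),
      (((A k 0 r : ℂ) - A k 0 (r + 1) + (if (r : ℤ) = 0 then A k 0 0 else 0 : ℤ)) * g r) := by
    rw [S1_eq I k 0 N (by omega)]
    have s1 := sum_shift_down (fun r => (A k 0 r : ℂ)) g N z4
    have s2 : ∀ r : ℤ, G I ((0 : ℕ) - 1) z r = - g (r - 1) := by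
      intro r
      have := G_shift I ((0 : ℕ) - 1) z (r - 1)
      rw [sub_add_cancel] at this
      rw [← neg_eq_iff_eq_neg.mpr this]; simp [hg]
    simp only [s2, add_sub_cancel_right, mul_sub, mul_neg, Finset.sum_sub_distrib,
      Finset.sum_neg_distrib, add_mul, sub_mul, Finset.sum_add_distrib]
    simp only [Nat.cast_zero] at *
    rw [s1, hg0]
    simp
    ring
  have e2 : -4 * (S2 I k 1 z - S I k 1 z) = ∑ r ∈ Finset.range (N + 1),
      ((A k 1 (r + 1) : ℂ) + 2 * A k 1 r + A k 1 (r - 1)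
        + (if (r : ℤ) = 0 then - A k 1 0 else 0 : ℤ)) * g r := by
    rw [S2_eq I k 1 N (by omega)]
    have s1 := sum_shift_down (fun r => (A k 1 r : ℂ)) g N z3
    have s2 := sum_shift_up (fun r => (A k 1 r : ℂ)) g N z1 z2
    simp only [Nat.cast_one, ← hg, mul_add, add_mul, Finset.sum_add_distrib]
    rw [s1, s2, hg0]
    simp only [mul_left_comm _ (2 : ℂ), mul_assoc, ← Finset.mul_sum]
    simp
    ring
  have e3 : S I (k + 1) 1 z = ∑ r ∈ Finset.range (N + 1), (A (k + 1) 1 r : ℂ) * g r := by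
    rw [S_eq I (k + 1) 1 N (by omega) z]; simp [hg]
  rw [e1, e2, e3]
  simp only [Finset.mul_sum, ← Finset.sum_sub_distrib, ← Finset.sum_add_distrib]
  have key := fun r : ℕ => coefs1 k r (by omega) (by omega)
  refine ⟨Finset.sum_congr rfl fun r _ => ?_, Finset.sum_congr rfl fun r _ => ?_⟩
  · have h := congrArg (Int.cast : ℤ → ℂ) (key r).1
    split_ifs at h ⊢ <;> push_cast at h ⊢ <;> linear_combination g r * h
  · have h := congrArg (Int.cast : ℤ → ℂ) (key r).2
    split_ifs at h ⊢ <;> push_cast at h ⊢ <;> linear_combination g r * h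

lemma E_zero (I : ℤ → ℂ → ℂ) (hsymm : ∀ ν : ℤ, I (-ν) = I ν) (k : ℕ) (hk : 1 ≤ k) (z : ℂ) :
    -4 * (S2 I k 0 z - S I k 0 z) = S I (k + 1) 0 z := by
  set N := k + 3 with hN
  set g := G I 0 z with hg
  have hg0 : g (-1) = g 1 := by
    simp only [hg, G]
    rw [show (0 : ℤ) + 2 * (-1) = -(0 + 2 * 1) by norm_num, hsymm]; norm_num
  have z1 : (A k 0 (-1) : ℂ) = 0 := by rw [A_zero _ _ _ (by omega)]; simp
  have z2 : (A k 0 (N : ℤ) : ℂ) = 0 := by rw [A_zero _ _ _ (by omega)]; simp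
  have z3 : (A k 0 ((N : ℤ) + 1) : ℂ) = 0 := by rw [A_zero _ _ _ (by omega)]; simp
  rw [S2_eq I k 0 N (by omega), S_eq I (k + 1) 0 N (by omega) z]
  have s1 := sum_shift_down (fun r => (A k 0 r : ℂ)) g N z3
  have s2 := sum_shift_up (fun r => (A k 0 r : ℂ)) g N z1 z2
  have s3 : ∑ r ∈ Finset.range (N + 1), ((if (r : ℤ) = 1 then A k 0 0 else 0 : ℤ) : ℂ) * g r
      = A k 0 0 * g 1 := by
    rw [Finset.sum_eq_single 1]
    · simp
    · intro b _ hb; rw [if_neg (by omega)]; simp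
    · intro h; simp at h
  have s4 : ∀ r : ℕ, (A ((k + 1 : ℕ) : ℤ) 0 r : ℂ) * g r = (A k 0 (r + 1) : ℂ) * g r
      + 2 * (A k 0 r * g r) + A k 0 (r - 1) * g r
      + ((if (r : ℤ) = 1 then A k 0 0 else 0 : ℤ) : ℂ) * g r := by
    intro r
    have h := congrArg (Int.cast : ℤ → ℂ) (coefs0 k r (by omega) (by omega))
    push_cast at h ⊢
    rw [h]; ring
  simp only [Nat.cast_zero, ← hg, s4, mul_add, Finset.sum_add_distrib, s3]
  simp only [mul_left_comm _ (2 : ℂ), ← Finset.mul_sum]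
  rw [s1, s2, hg0]
  ring

open Polynomial in
/-- `P_k` as a polynomial -/
noncomputable def Pp (k : ℕ) : ℂ[X] := X ^ k * (1 - X) ^ (k - 1)

open Polynomial in
/-- iterated derivatives of `P_k` -/
noncomputable def DP (k l : ℕ) : ℂ[X] := derivative^[l] (Pp k)

lemma DP_succ (k l : ℕ) : DP k (l + 1) = Polynomial.derivative (DP k l) := by
  simp only [DP, Function.iterate_succ_apply']

lemma hasDerivAt_DP (k l : ℕ) (v : ℂ) :
    HasDerivAt (fun v => (DP k l).eval v) ((DP k (l + 1)).eval v) v := by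
  rw [DP_succ]; exact (DP k l).hasDerivAt v

lemma iteratedDeriv_Pc (k l : ℕ) : iteratedDeriv l (Pc k) = fun v => (DP k l).eval v := by
  induction l with
  | zero => funext v; simp [Pc, DP, Pp]
  | succ l ih => 
    rw [iteratedDeriv_succ, ih]
    funext v
    exact (hasDerivAt_DP k l v).deriv

open Polynomial in
lemma rod0 (k : ℕ) (hk : 1 ≤ k) :
    (X : ℂ[X]) * (1 - X) * DP k 1 = ((k : ℂ[X]) - (2 * (k : ℂ[X]) - 1) * (X : ℂ[X])) * DP k 0 := by
  obtain ⟨j, rfl⟩ : ∃ j, k = j + 1 := ⟨k - 1, by omega⟩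
  simp only [DP, Pp, Function.iterate_one, Function.iterate_zero, id, Nat.add_sub_cancel]
  rcases j with _ | j
  · simp; ring
  · simp only [derivative_mul, derivative_X_pow, derivative_pow, derivative_sub, derivative_one,
      derivative_X, Nat.add_sub_cancel, map_natCast]
    push_cast; ring

open Polynomial in
lemma DP_up (k : ℕ) (hk : 1 ≤ k) : DP (k + 1) 0 = X * (1 - X) * DP k 0 := by
  obtain ⟨j, rfl⟩ : ∃ j, k = j + 1 := ⟨k - 1, by omega⟩
  simp only [DP, Pp, Function.iterate_zero, id, Nat.add_sub_cancel]
  ring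

open Polynomial in
lemma DP_up1 (k : ℕ) (hk : 1 ≤ k) :
    DP (k + 1) 1 = (X : ℂ[X]) * (1 - X) * DP k 1 + (1 - 2 * (X : ℂ[X])) * DP k 0 := by
  rw [DP_succ, DP_up k hk, DP_succ]
  simp only [derivative_mul, derivative_sub, derivative_one, derivative_X]; ring

open Polynomial in
lemma DP_up2 (k : ℕ) (hk : 1 ≤ k) (n : ℕ) :
    DP (k + 1) (n + 2) = (X : ℂ[X]) * (1 - X) * DP k (n + 2)
      + ((n : ℂ[X]) + 2) * (1 - 2 * (X : ℂ[X])) * DP k (n + 1)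
      - ((n : ℂ[X]) + 2) * ((n : ℂ[X]) + 1) * DP k n := by
  induction n with
  | zero =>
    rw [DP_succ, DP_up1 k hk, DP_succ k 1]
    simp only [derivative_mul, derivative_sub, derivative_add, derivative_one, derivative_X,
      ← DP_succ, derivative_ofNat, derivative_natCast]
    push_cast; ring
  | succ n ih =>
    rw [DP_succ, ih]
    simp only [derivative_mul, derivative_sub, derivative_add, derivative_one, derivative_X,
      ← DP_succ, derivative_ofNat, derivative_natCast]
    push_cast; ring

open Polynomial in
lemma rod (k : ℕ) (hk : 1 ≤ k) (n : ℕ) :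
    (X : ℂ[X]) * (1 - X) * DP k (n + 2) = ((k : ℂ[X]) - (n : ℂ[X]) - 1) * DP k (n + 1)
      - (2 * (k : ℂ[X]) - 2 * (n : ℂ[X]) - 3) * (X : ℂ[X]) * DP k (n + 1)
      - ((n : ℂ[X]) + 1) * (2 * (k : ℂ[X]) - (n : ℂ[X]) - 1) * DP k n := by
  induction n with
  | zero =>
    have h := congrArg derivative (rod0 k hk)
    simp only [derivative_mul, derivative_sub, derivative_add, derivative_one, derivative_X,
      ← DP_succ, derivative_ofNat, derivative_natCast] at h
    push_cast
    linear_combination h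
  | succ n ih =>
    have h := congrArg derivative ih
    simp only [derivative_mul, derivative_sub, derivative_add, derivative_one, derivative_X,
      ← DP_succ, derivative_ofNat, derivative_natCast] at h
    push_cast
    linear_combination h

open Polynomial in
lemma down (k : ℕ) (hk : 1 ≤ k) (n : ℕ) :
    ((k : ℂ[X]) - 1) * (k : ℂ[X]) * DP (k - 1) n = (X : ℂ[X]) * (1 - X) * DP k (n + 2)
      + (n : ℂ[X]) * (1 - 2 * (X : ℂ[X])) * DP k (n + 1)
      - (n : ℂ[X]) * ((n : ℂ[X]) - 1) * DP k n - 2 * (X : ℂ[X]) * DP k (n + 1)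
      - 2 * (n : ℂ[X]) * DP k n + 2 * (k : ℂ[X]) * (2 * (k : ℂ[X]) - 1) * DP k n := by
  induction n with
  | zero =>
    rcases (show k = 1 ∨ 2 ≤ k by omega) with rfl | h2
    · simp [DP, Pp]; ring
    · obtain ⟨j, rfl⟩ : ∃ j, k = j + 1 := ⟨k - 1, by omega⟩
      have h0 := rod0 j (by omega)
      have h1 : DP (j + 1) 1 = ((j : ℂ[X]) + 1 - (2 * (j : ℂ[X]) + 1) * (X : ℂ[X])) * DP j 0 := by
        rw [DP_up1 j (by omega)]; linear_combination h0
      have h3 : DP (j + 1) 2 = ((j : ℂ[X]) + 1 - (2 * (j : ℂ[X]) + 1) * (X : ℂ[X])) * DP j 1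
          - (2 * (j : ℂ[X]) + 1) * DP j 0 := by
        rw [DP_succ, h1]
        simp only [derivative_mul, derivative_sub, derivative_add, derivative_one, derivative_X,
          ← DP_succ, derivative_ofNat, derivative_natCast]
        push_cast; ring
      rw [zero_add, zero_add, h1, h3, DP_up j (by omega), Nat.add_sub_cancel]
      push_cast
      linear_combination (-((j : ℂ[X]) + 1 - (2 * (j : ℂ[X]) + 1) * (X : ℂ[X]))) * h0
  | succ n ih =>
    have h := congrArg derivative ih
    simp only [derivative_mul, derivative_sub, derivative_add, derivative_one, derivative_X,
      ← DP_succ, derivative_ofNat, derivative_natCast] at h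
    push_cast
    linear_combination h

lemma hasDerivAt_S (I : ℤ → ℂ → ℂ)
    (hI : ∀ (ν : ℤ) (z : ℂ), HasDerivAt (I ν) ((I (ν - 1) z + I (ν + 1) z) / 2) z)
    (k l : ℕ) (z : ℂ) : HasDerivAt (S I k l) (S1 I k l z) z := by
  unfold S S1
  exact HasDerivAt.fun_sum fun r _ => (hI _ z).const_mul _

lemma hasDerivAt_S1 (I : ℤ → ℂ → ℂ)
    (hI : ∀ (ν : ℤ) (z : ℂ), HasDerivAt (I ν) ((I (ν - 1) z + I (ν + 1) z) / 2) z)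
    (k l : ℕ) (z : ℂ) : HasDerivAt (S1 I k l) (S2 I k l z) z := by
  unfold S1 S2
  refine HasDerivAt.fun_sum fun r _ => HasDerivAt.const_mul _ ?_
  refine (((hI (l + 2 * r - 1) z).add (hI (l + 2 * r + 1) z)).div_const 2).congr_deriv ?_
  rw [show (l : ℤ) + 2 * r - 1 - 1 = l + 2 * r - 2 by ring, sub_add_cancel, add_sub_cancel_right,
    show (l : ℤ) + 2 * r + 1 + 1 = l + 2 * r + 2 by ring]
  ring

theorem stmt_19 (I : ℤ → ℂ → ℂ)
    (hdiff : ∀ ν : ℤ, Differentiable ℂ (I ν))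
    (hsymm : ∀ ν : ℤ, I (-ν) = I ν)
    (hrec : ∀ (ν : ℤ) (z : ℂ), 2 * deriv (I ν) z = I (ν - 1) z + I (ν + 1) z)
    (k : ℕ) (hk : 1 ≤ k) (a : ℂ) (ha : a ≠ 0) (v : ℂ) :
    a ^ 2 * Sfun I (k + 1) a v =
      -4 * (Qc v * (iteratedDeriv 2 (Sfun I k a) v - a ^ 2 * Sfun I k a v)
        + Rc v * deriv (Sfun I k a) v + ((k : ℂ) ^ 2 - 1) * Sfun I k a v
        - ((k : ℂ) - 1) * (k : ℂ) * Sfun I (k - 1) a v) := by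
  have hI : ∀ (ν : ℤ) (z : ℂ), HasDerivAt (I ν) ((I (ν - 1) z + I (ν + 1) z) / 2) z := by
    intro ν z
    refine (hdiff ν z).hasDerivAt.congr_deriv ?_
    rw [← hrec]; ring
  have hav : ∀ w : ℂ, HasDerivAt (fun w => a * w) a w := fun w => by
    simpa using (hasDerivAt_id w).const_mul a
  have hS : ∀ l w, HasDerivAt (fun w => S I k l (a * w)) (S1 I k l (a * w) * a) w := fun l w =>
    HasDerivAt.comp w (hasDerivAt_S I hI k l (a * w)) (hav w)
  have hS1 : ∀ l w, HasDerivAt (fun w => S1 I k l (a * w)) (S2 I k l (a * w) * a) w := fun l w =>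
    HasDerivAt.comp w (hasDerivAt_S1 I hI k l (a * w)) (hav w)
  set u := -2 / a with hu
  have hf0 : ∀ k, Sfun I k a = fun w => ∑ l ∈ Finset.range (k + 1),
      u ^ l * (DP k l).eval w * S I k l (a * w) := by
    intro k; unfold Sfun; simp only [iteratedDeriv_Pc]; rfl
  have hf1 : deriv (Sfun I k a) = fun w => ∑ l ∈ Finset.range (k + 1),
      (u ^ l * (DP k (l + 1)).eval w * S I k l (a * w)
        + u ^ l * (DP k l).eval w * (S1 I k l (a * w) * a)) := by
    funext w
    rw [hf0]
    exact (HasDerivAt.fun_sum fun l _ =>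
      ((hasDerivAt_DP k l w).const_mul (u ^ l)).mul (hS l w)).deriv
  have hf2 : iteratedDeriv 2 (Sfun I k a) = fun w => ∑ l ∈ Finset.range (k + 1),
      ((u ^ l * (DP k (l + 2)).eval w * S I k l (a * w)
        + u ^ l * (DP k (l + 1)).eval w * (S1 I k l (a * w) * a))
       + (u ^ l * (DP k (l + 1)).eval w * (S1 I k l (a * w) * a)
        + u ^ l * (DP k l).eval w * (S2 I k l (a * w) * a * a))) := by
    rw [iteratedDeriv_succ, iteratedDeriv_one]
    funext w
    rw [hf1]
    exact (HasDerivAt.fun_sum fun l _ =>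
      (((hasDerivAt_DP k (l + 1) w).const_mul (u ^ l)).mul (hS l w)).add
      (((hasDerivAt_DP k l w).const_mul (u ^ l)).mul ((hS1 l w).mul_const a))).deriv
  have hau : a * u = -2 := by rw [hu]; field_simp
  have hu2 : ∀ n, a ^ 2 * u ^ (n + 2) = 4 * u ^ n := by
    intro n; linear_combination (u ^ n * (a * u - 2)) * hau
  have hu1 : ∀ n, a * u ^ (n + 1) = -2 * u ^ n := by
    intro n; linear_combination u ^ n * hau
  -- vanishing
  have hSz : ∀ (k l : ℕ) (z : ℂ), k < l → S I k l z = 0 := by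
    intro k l z h
    rw [S_eq I k l k le_rfl]
    refine Finset.sum_eq_zero fun r _ => ?_
    rw [A_zero _ _ _ (by omega)]; simp
  have hS2z : ∀ (k l : ℕ) (z : ℂ), k < l → -4 * (S2 I k l z - S I k l z) = 0 := by
    intro k l z h
    rw [S2_eq I k l k le_rfl]
    refine Finset.sum_eq_zero fun r _ => ?_
    rw [A_zero _ _ _ (by omega)]; simp
  have hS1z : ∀ (k l : ℕ) (z : ℂ), k < l → 2 * S1 I k l z = 0 := by
    intro k l z h
    rw [S1_eq I k l k le_rfl]
    refine Finset.sum_eq_zero fun r _ => ?_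
    rw [A_zero _ _ _ (by omega)]; simp
  set z := a * v with hz
  let L : ℕ → ℂ := fun m => a ^ 2 * u ^ m * ((DP (k + 1) m).eval v * S I (k + 1) m z)
  let T1 : ℕ → ℂ := fun m => a ^ 2 * u ^ m *
    (Qc v * (DP k m).eval v * (-4 * (S2 I k m z - S I k m z)))
  let T2 : ℕ → ℂ := fun l => a * u ^ l *
    (-4 * (Qc v * (DP k (l + 1)).eval v) * (2 * S1 I k l z)
      - 2 * (Rc v * (DP k l).eval v) * (2 * S1 I k l z))
  let T3 : ℕ → ℂ := fun l => u ^ l * (-4 * (Qc v * (DP k (l + 2)).eval v * S I k l z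
    + Rc v * (DP k (l + 1)).eval v * S I k l z + ((k : ℂ) ^ 2 - 1) * (DP k l).eval v * S I k l z
    - ((k : ℂ) - 1) * k * (DP (k - 1) l).eval v * S I (k - 1) l z))
  have step : ∀ n, L (n + 2) = T1 (n + 2) + T2 (n + 1) + T3 n := by
    intro n
    obtain ⟨F2, F1, F3⟩ := E_gen I k n hk z
    have hL := congrArg (Polynomial.eval v) (DP_up2 k hk n)
    have hR := congrArg (Polynomial.eval v) (rod k hk n)
    have hE := congrArg (Polynomial.eval v) (down k hk n)
    simp only [Polynomial.eval_add, Polynomial.eval_sub, Polynomial.eval_mul, Polynomial.eval_X,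
      Polynomial.eval_one, Polynomial.eval_ofNat, Polynomial.eval_natCast] at hL hR hE
    simp only [L, T1, T2, T3, hu2, hu1, Qc, Rc]
    linear_combination (4 * u ^ n) * (S I (k + 1) (n + 2) z * hL - S I (k - 1) n z * hE
      - (v * (1 - v) * (DP k (n + 2)).eval v) * F2
      - (2 * S1 I k (n + 1) z - S I k n z + 2 * S I (k - 1) n z) * hR
      + ((DP k (n + 1)).eval v * (1 - 2 * v) - (n + 1) * (DP k n).eval v) * F1
      + (DP k n).eval v * F3)
  have step1 : L 1 = T1 1 + T2 0 := by
    obtain ⟨F2, F1⟩ := E_one I hsymm k hk z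
    have hL := congrArg (Polynomial.eval v) (DP_up1 k hk)
    have hR := congrArg (Polynomial.eval v) (rod0 k hk)
    simp only [Polynomial.eval_add, Polynomial.eval_sub, Polynomial.eval_mul, Polynomial.eval_X,
      Polynomial.eval_one, Polynomial.eval_ofNat, Polynomial.eval_natCast] at hL hR
    have h1 := hu1 0
    have h2 : a ^ 2 * u ^ 1 = -2 * a := by linear_combination a * h1
    simp only [L, T1, T2, h2, Qc, Rc]
    rw [hL]
    linear_combination (-2 * a) * (-(v * (1 - v) * (DP k 1).eval v) * F2
      - (2 * S1 I k 0 z) * hR + ((DP k 0).eval v * (1 - 2 * v)) * F1)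
  have step0 : L 0 = T1 0 := by
    have F2 := E_zero I hsymm k hk z
    have hL := congrArg (Polynomial.eval v) (DP_up k hk)
    simp only [Polynomial.eval_sub, Polynomial.eval_mul, Polynomial.eval_X,
      Polynomial.eval_one] at hL
    simp only [L, T1, Qc]
    rw [hL, F2]
  have total : ∑ m ∈ Finset.range (k + 3), L m = ∑ m ∈ Finset.range (k + 3), T1 m
      + ∑ m ∈ Finset.range (k + 2), T2 m + ∑ m ∈ Finset.range (k + 1), T3 m := by
    rw [Finset.sum_range_succ' L, Finset.sum_range_succ' _ (k + 1), Finset.sum_range_succ' T1,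
      Finset.sum_range_succ' _ (k + 1), Finset.sum_range_succ' T2]
    simp only [zero_add, step0, step1, add_assoc, Nat.reduceAdd]
    simp only [step, Finset.sum_add_distrib]
    ring
  rw [Finset.sum_range_succ L, Finset.sum_range_succ T1, Finset.sum_range_succ T1,
    Finset.sum_range_succ T2] at total
  have v1 : L (k + 2) = 0 := by simp only [L]; rw [hSz _ _ _ (by omega)]; simp
  have v2 : T1 (k + 2) = 0 := by simp only [T1]; rw [hS2z _ _ _ (by omega)]; simp
  have v3 : T1 (k + 1) = 0 := by simp only [T1]; rw [hS2z _ _ _ (by omega)]; simp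
  have v4 : T2 (k + 1) = 0 := by simp only [T2]; rw [hS1z _ _ _ (by omega)]; simp
  rw [v1, v2, v3, v4, add_zero, add_zero, add_zero, add_zero] at total
  have hlast : ((k : ℂ) - 1) * k * Sfun I (k - 1) a v = ∑ l ∈ Finset.range (k + 1),
      ((k : ℂ) - 1) * k * (u ^ l * (DP (k - 1) l).eval v * S I (k - 1) l z) := by
    rw [hf0 (k - 1), ← Finset.mul_sum, Finset.sum_range_succ _ k, hSz (k - 1) k z (by omega),
      Nat.sub_add_cancel hk]
    simp [hz]
  rw [hlast, hf2, hf1, hf0 (k + 1), hf0 k]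
  have hLHS : a ^ 2 * (fun w => ∑ l ∈ Finset.range (k + 1 + 1),
      u ^ l * (DP (k + 1) l).eval w * S I (k + 1) l (a * w)) v
      = ∑ m ∈ Finset.range (k + 2), L m := by
    simp only [Finset.mul_sum, L]
    exact Finset.sum_congr rfl fun l _ => by rw [hz]; ring
  rw [hLHS, total, ← Finset.sum_add_distrib, ← Finset.sum_add_distrib]
  simp only [Finset.mul_sum, ← Finset.sum_add_distrib, ← Finset.sum_sub_distrib]
  refine Finset.sum_congr rfl fun l _ => ?_
  simp only [T1, T2, T3, hz]
  ring
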